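/- For |v| < 1, the integral ∫_{ℝ³} |ρ̂(k)|² (k² - (k·v)²)⁻¹ dk minus suitable projections yields the soliton momentum formula: m_b γ v + m_e |v|⁻² [ (1+v²)/(2|v|) log((1+|v|)/(1-|v|)) - 1 ] v, where the field part of the momentum ∫ d³k |ρ̂(k)|² ( [k² - (k·v)²]⁻¹ v - γ⁻² [k² - (k·v)²]⁻² (k·v) k ) equals m_e |v|⁻² [ (1+v²)/(2|v|) log((1+|v|)/(1-|v|)) - 1 ] v with m_e = (1/2)∫ d³k |ρ̂(k)|²/k². -/

import Mathlib

open MeasureTheory Real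
open scoped RealInnerProductSpace

/-- Polar coordinates for the product of a function of the direction and a function of the norm. -/
theorem integral_direction_mul_norm {E : Type*} [NormedAddCommGroup E] [NormedSpace ℝ E]
    [Nontrivial E] [MeasurableSpace E] [BorelSpace E] [FiniteDimensional ℝ E]
    (μ : Measure E) [μ.IsAddHaarMeasure] (h : E → ℝ) (g : ℝ → ℝ) :
    ∫ k, h (‖k‖⁻¹ • k) * g ‖k‖ ∂μ
      = (∫ ω, h ω ∂μ.toSphere) *
        ∫ y in Set.Ioi (0 : ℝ), y ^ (Module.finrank ℝ E - 1) * g y := by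
  calc
    ∫ k, h (‖k‖⁻¹ • k) * g ‖k‖ ∂μ
        = ∫ x : ({(0)}ᶜ : Set E), h (‖x.1‖⁻¹ • x.1) * g ‖x.1‖ ∂(μ.comap (↑)) := by
      rw [integral_subtype_comap (measurableSet_singleton _).compl
        fun x ↦ h (‖x‖⁻¹ • x) * g ‖x‖, restrict_compl_singleton]
    _ = ∫ x, h x.1 * g x.2 ∂μ.toSphere.prod (.volumeIoiPow (Module.finrank ℝ E - 1)) := by
      simpa using μ.measurePreserving_homeomorphUnitSphereProd.integral_comp
        (Homeomorph.measurableEmbedding _)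
        (fun x : Metric.sphere (0 : E) 1 × Set.Ioi (0 : ℝ) ↦ h x.1 * g x.2)
    _ = (∫ ω, h ω ∂μ.toSphere) *
        ∫ x : Set.Ioi (0 : ℝ), g x ∂.volumeIoiPow (Module.finrank ℝ E - 1) :=
      integral_prod_mul (fun ω : Metric.sphere (0 : E) 1 ↦ h ω) fun x : Set.Ioi (0 : ℝ) ↦ g x
    _ = _ := by
      congr 1
      simp only [Measure.volumeIoiPow, ENNReal.ofReal]
      rw [integral_withDensity_eq_integral_smul,
        integral_subtype_comap measurableSet_Ioi
          fun a ↦ Real.toNNReal (a ^ (Module.finrank ℝ E - 1)) • g a,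
        setIntegral_congr_fun measurableSet_Ioi fun x hx ↦ ?_]
      · rw [NNReal.smul_def, Real.coe_toNNReal _ (pow_nonneg hx.out.le _), smul_eq_mul]
      · exact (measurable_subtype_coe.pow_const _).real_toNNReal

theorem integral_Ioi_pow_mul_exp_neg_sq (m : ℕ) :
    ∫ x in Set.Ioi (0 : ℝ), x ^ m * exp (-x ^ 2) = 1 / 2 * Gamma ((m + 1) / 2) := by
  have := integral_rpow_mul_exp_neg_rpow (p := 2) (q := m) two_pos
    (by linarith [m.cast_nonneg (α := ℝ)])
  exact_mod_cast this

theorem integral_even_pow_mul_exp_neg_sq (n : ℕ) :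
    ∫ x : ℝ, x ^ (2 * n) * exp (-x ^ 2) = Gamma (n + 1 / 2) := by
  have h := integral_comp_abs (f := fun x : ℝ ↦ x ^ (2 * n) * exp (-x ^ 2))
  simp only [sq_abs, pow_mul] at h
  simp only [pow_mul, h]
  simp only [← pow_mul]
  rw [integral_Ioi_pow_mul_exp_neg_sq]
  push_cast
  rw [← mul_assoc, mul_one_div_cancel two_ne_zero, one_mul]
  congr 1
  ring

/-- The even moments of a Gaussian in a fixed direction. -/
theorem integral_inner_pow_mul_exp_neg_norm_sq {e : EuclideanSpace ℝ (Fin 3)} (he : ‖e‖ = 1)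
    (n : ℕ) :
    ∫ k : EuclideanSpace ℝ (Fin 3), ⟪k, e⟫ ^ (2 * n) * exp (-‖k‖ ^ 2)
      = π * Gamma (n + 1 / 2) := by
  obtain ⟨b, hb⟩ := Orthonormal.exists_orthonormalBasis_extension_of_card_eq (𝕜 := ℝ)
    (E := EuclideanSpace ℝ (Fin 3)) (ι := Fin 3) (by simp) (v := fun _ ↦ e) (s := {0})
    (by constructor
        · intro i; exact he
        · intro i j hij; exact absurd (Subsingleton.elim i j) hij)
  have hb0 : b 0 = e := hb 0 rfl
  let φ : Fin 3 → ℝ → ℝ := fun i t ↦ t ^ (2 * if i = 0 then n else 0) * exp (-t ^ 2)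
  have key : ∀ k : EuclideanSpace ℝ (Fin 3), ⟪k, e⟫ ^ (2 * n) * exp (-‖k‖ ^ 2)
      = ∏ i, φ i (b.repr k i) := by
    intro k
    rw [← b.repr.norm_map k, EuclideanSpace.norm_sq_eq, Fin.sum_univ_three]
    simp only [φ, Fin.prod_univ_three, Real.norm_eq_abs, sq_abs, neg_add, exp_add]
    rw [← hb0, real_inner_comm, ← b.repr_apply_apply]
    simp
    ring
  rw [integral_congr_ae (.of_forall key)]
  refine (((PiLp.volume_preserving_ofLp (Fin 3)).comp
      b.repr.measurePreserving).integral_comp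
    ((MeasurableEquiv.toLp 2 (Fin 3 → ℝ)).symm.measurableEmbedding.comp
      b.repr.toHomeomorph.measurableEmbedding)
    (fun x : Fin 3 → ℝ ↦ ∏ i, φ i (x i))).trans ?_
  refine (integral_fintype_prod_volume_eq_prod φ).trans ?_
  simp only [φ, integral_even_pow_mul_exp_neg_sq, Fin.prod_univ_three]
  simp [-one_div]
  rw [Real.Gamma_one_half_eq, mul_assoc, Real.mul_self_sqrt pi_pos.le, mul_comm]

theorem integral_sphere_inner_pow {e : EuclideanSpace ℝ (Fin 3)} (he : ‖e‖ = 1) (n : ℕ) :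
    ∫ ω : Metric.sphere (0 : EuclideanSpace ℝ (Fin 3)) 1, (⟪ω.1, e⟫ ^ 2) ^ n ∂volume.toSphere
      = 4 * π * ∫ t in (0 : ℝ)..1, (t ^ 2) ^ n := by
  have h := integral_direction_mul_norm (volume : Measure (EuclideanSpace ℝ (Fin 3)))
    (fun k ↦ (⟪k, e⟫ ^ 2) ^ n) (fun r ↦ r ^ (2 * n) * exp (-r ^ 2))
  have hk : ∀ k : EuclideanSpace ℝ (Fin 3),
      (⟪‖k‖⁻¹ • k, e⟫ ^ 2) ^ n * (‖k‖ ^ (2 * n) * exp (-‖k‖ ^ 2))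
        = ⟪k, e⟫ ^ (2 * n) * exp (-‖k‖ ^ 2) := by
    intro k
    rcases eq_or_ne k 0 with rfl | hk
    · rcases n.eq_zero_or_pos with rfl | hn
      · simp
      · simp [hn.ne']
    · have : ‖k‖ ≠ 0 := norm_ne_zero_iff.2 hk
      rw [real_inner_smul_left, ← pow_mul, ← mul_assoc, ← mul_pow]
      field_simp
  have hr : ∀ y : ℝ, y ^ (Module.finrank ℝ (EuclideanSpace ℝ (Fin 3)) - 1) *
      (y ^ (2 * n) * exp (-y ^ 2)) = y ^ (2 * n + 2) * exp (-y ^ 2) := by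
    intro y
    simp only [finrank_euclideanSpace, Fintype.card_fin]
    ring
  simp only [hk, hr] at h
  rw [integral_inner_pow_mul_exp_neg_norm_sq he, integral_Ioi_pow_mul_exp_neg_sq] at h
  have hG : Gamma (((2 * n + 2 : ℕ) + 1) / 2) = (n + 1 / 2) * Gamma (n + 1 / 2) := by
    rw [← Real.Gamma_add_one (by positivity)]
    congr 1
    push_cast
    ring
  have hpos : 0 < Gamma ((n : ℝ) + 1 / 2) := Real.Gamma_pos_of_pos (by positivity)
  rw [hG] at h
  simp only [← pow_mul, integral_pow] at h ⊢
  have h' := mul_right_cancel₀ hpos.ne' (h.trans (by ring :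
    _ = ((∫ ω : Metric.sphere (0 : EuclideanSpace ℝ (Fin 3)) 1,
      ⟪ω.1, e⟫ ^ (2 * n) ∂volume.toSphere) * (1 / 2 * (n + 1 / 2))) * Gamma (n + 1 / 2)))
  push_cast
  field_simp
  simp
  linarith

/-- Archimedes' hat-box theorem for even functions of the height. -/
theorem integral_sphere_comp_inner_sq {e : EuclideanSpace ℝ (Fin 3)} (he : ‖e‖ = 1) {h : ℝ → ℝ}
    (hh : ContinuousOn h (Set.Icc 0 1)) :
    ∫ ω : Metric.sphere (0 : EuclideanSpace ℝ (Fin 3)) 1, h (⟪ω.1, e⟫ ^ 2) ∂volume.toSphere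
      = 4 * π * ∫ t in (0 : ℝ)..1, h (t ^ 2) := by
  have hmem : ∀ ω : Metric.sphere (0 : EuclideanSpace ℝ (Fin 3)) 1,
      ⟪ω.1, e⟫ ^ 2 ∈ Set.Icc (0 : ℝ) 1 := by
    intro ω
    refine ⟨sq_nonneg _, (sq_le_one_iff_abs_le_one _).2 ?_⟩
    have hω : ‖ω.1‖ = 1 := by simp
    simpa [he, hω] using abs_real_inner_le_norm ω.1 e
  have hmem' : ∀ t ∈ Set.uIcc (0 : ℝ) 1, t ^ 2 ∈ Set.Icc (0 : ℝ) 1 := by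
    intro t ht
    rw [Set.uIcc_of_le zero_le_one] at ht
    exact ⟨sq_nonneg _, pow_le_one₀ ht.1 ht.2⟩
  have hcω : Continuous fun ω : Metric.sphere (0 : EuclideanSpace ℝ (Fin 3)) 1 ↦
      ⟪ω.1, e⟫ ^ 2 := by fun_prop
  have hsph : ∀ {f : ℝ → ℝ}, ContinuousOn f (Set.Icc 0 1) →
      Integrable (fun ω : Metric.sphere (0 : EuclideanSpace ℝ (Fin 3)) 1 ↦ f (⟪ω.1, e⟫ ^ 2))
        volume.toSphere := fun hf ↦
    (hf.comp_continuous hcω hmem).integrable_of_hasCompactSupport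
      (HasCompactSupport.of_compactSpace _)
  have hint : ∀ {f : ℝ → ℝ}, ContinuousOn f (Set.Icc 0 1) →
      IntervalIntegrable (fun t ↦ f (t ^ 2)) volume 0 1 := fun hf ↦
    (hf.comp (by fun_prop) hmem').intervalIntegrable
  have hpoly : ∀ p : Polynomial ℝ,
      ∫ ω : Metric.sphere (0 : EuclideanSpace ℝ (Fin 3)) 1, p.eval (⟪ω.1, e⟫ ^ 2)
        ∂volume.toSphere = 4 * π * ∫ t in (0 : ℝ)..1, p.eval (t ^ 2) := by
    intro p
    induction p using Polynomial.induction_on' with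
    | add p q hp hq =>
      simp only [Polynomial.eval_add]
      rw [integral_add (hsph p.continuousOn) (hsph q.continuousOn),
        intervalIntegral.integral_add (hint p.continuousOn) (hint q.continuousOn), hp, hq]
      ring
    | monomial n a =>
      simp only [Polynomial.eval_monomial]
      rw [integral_const_mul, intervalIntegral.integral_const_mul, integral_sphere_inner_pow he]
      ring
  have harea : (volume : Measure (EuclideanSpace ℝ (Fin 3))).toSphere.real Set.univ = 4 * π := by
    simpa using hpoly 1
  refine eq_of_abs_sub_le_all fun ε hε ↦ ?_
  have hδ : 0 < ε / (8 * π) := by positivity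
  obtain ⟨p, hp⟩ := exists_polynomial_near_of_continuousOn 0 1 h hh _ hδ
  have h1 : |(∫ ω : Metric.sphere (0 : EuclideanSpace ℝ (Fin 3)) 1, p.eval (⟪ω.1, e⟫ ^ 2)
      ∂volume.toSphere) - ∫ ω : Metric.sphere (0 : EuclideanSpace ℝ (Fin 3)) 1, h (⟪ω.1, e⟫ ^ 2)
      ∂volume.toSphere| ≤ ε / (8 * π) * (4 * π) := by
    rw [← integral_sub (hsph p.continuousOn) (hsph hh), ← harea]
    exact norm_integral_le_of_norm_le_const (C := ε / (8 * π))
      (f := fun ω : Metric.sphere (0 : EuclideanSpace ℝ (Fin 3)) 1 ↦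
        p.eval (⟪ω.1, e⟫ ^ 2) - h (⟪ω.1, e⟫ ^ 2)) (.of_forall fun ω ↦ (hp _ (hmem ω)).le)
  have h2 : |(∫ t in (0 : ℝ)..1, p.eval (t ^ 2)) - ∫ t in (0 : ℝ)..1, h (t ^ 2)|
      ≤ ε / (8 * π) := by
    rw [← intervalIntegral.integral_sub (hint p.continuousOn) (hint hh)]
    simpa using intervalIntegral.norm_integral_le_of_norm_le_const (a := (0 : ℝ)) (b := 1)
      (f := fun t ↦ p.eval (t ^ 2) - h (t ^ 2)) fun t ht ↦
        (hp _ (hmem' t (Set.uIoc_subset_uIcc ht))).le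
  rw [hpoly p] at h1
  have hε' : ε / (8 * π) * (4 * π) = ε / 2 := by field_simp; norm_num
  rw [hε'] at h1
  have h3 : 4 * π * |(∫ t in (0 : ℝ)..1, p.eval (t ^ 2)) - ∫ t in (0 : ℝ)..1, h (t ^ 2)|
      ≤ ε / 2 := by
    rw [← hε', mul_comm (ε / (8 * π))]
    gcongr
  rw [← abs_of_pos (by positivity : 0 < 4 * π), ← abs_mul, mul_sub] at h3
  rw [abs_le] at h1 h3 ⊢
  constructor <;> linarith [h1.1, h1.2, h3.1, h3.2]

/-- The angular integral occurring in the field momentum of a soliton with speed `s`. -/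
theorem integral_angular_momentum_density {s : ℝ} (hs0 : 0 < s) (hs1 : s < 1) :
    ∫ t in (0 : ℝ)..1, ((1 - s ^ 2 * t ^ 2)⁻¹ -
        (1 - s ^ 2) * ((1 - s ^ 2 * t ^ 2) ^ 2)⁻¹ * t ^ 2)
      = (2 * s ^ 2)⁻¹ * ((1 + s ^ 2) / (2 * s) * log ((1 + s) / (1 - s)) - 1) := by
  have hpos : ∀ t ∈ Set.uIcc (0 : ℝ) 1, 0 < 1 - s * t ∧ 0 < 1 + s * t := by
    intro t ht
    rw [Set.uIcc_of_le zero_le_one] at ht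
    constructor <;> nlinarith [ht.1, ht.2]
  have hfac : ∀ t : ℝ, 1 - s ^ 2 * t ^ 2 = (1 - s * t) * (1 + s * t) := fun t ↦ by ring
  have hne : ∀ t ∈ Set.uIcc (0 : ℝ) 1, 1 - s ^ 2 * t ^ 2 ≠ 0 := fun t ht ↦ by
    rw [hfac]
    exact (mul_pos (hpos t ht).1 (hpos t ht).2).ne'
  have hd : ∀ t ∈ Set.uIcc (0 : ℝ) 1, HasDerivAt
      (fun t ↦ (1 + s ^ 2) / (4 * s ^ 3) * (log (1 + s * t) - log (1 - s * t))
        - (1 - s ^ 2) / (2 * s ^ 2) * (t / (1 - s ^ 2 * t ^ 2)))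
      ((1 - s ^ 2 * t ^ 2)⁻¹ - (1 - s ^ 2) * ((1 - s ^ 2 * t ^ 2) ^ 2)⁻¹ * t ^ 2) t := by
    intro t ht
    have ha : HasDerivAt (fun t ↦ 1 + s * t) s t := by
      simpa using ((hasDerivAt_id t).const_mul s).const_add 1
    have hb : HasDerivAt (fun t ↦ 1 - s * t) (-s) t := by
      simpa using ((hasDerivAt_id t).const_mul s).const_sub 1
    have hc : HasDerivAt (fun t ↦ 1 - s ^ 2 * t ^ 2) (-(s ^ 2 * (2 * t))) t := by
      simpa using ((hasDerivAt_pow 2 t).const_mul (s ^ 2)).const_sub 1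
    obtain ⟨h1, h2⟩ := hpos t ht
    have h3 := hne t ht
    refine ((((ha.log h2.ne').sub (hb.log h1.ne')).const_mul _).sub
      (((hasDerivAt_id t).div hc h3).const_mul _)).congr_deriv ?_
    simp only [id]
    rw [hfac]
    have := h1.ne'
    have := h2.ne'
    field_simp
    ring
  rw [intervalIntegral.integral_eq_sub_of_hasDerivAt hd]
  · have h1 : 1 - s ≠ 0 := by linarith
    have h2 : 1 + s ≠ 0 := by linarith
    have h3 : 1 - s ^ 2 ≠ 0 := by nlinarith
    rw [log_div h2 h1]
    simp
    field_simp
    ring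
  · refine ContinuousOn.intervalIntegrable ?_
    have hc : ContinuousOn (fun t : ℝ ↦ 1 - s ^ 2 * t ^ 2) (Set.uIcc 0 1) := by fun_prop
    exact (hc.inv₀ hne).sub ((continuousOn_const.mul
      ((hc.pow 2).inv₀ fun t ht ↦ pow_ne_zero 2 (hne t ht))).mul (by fun_prop))

/-- A vector-valued integral that is equivariant under the reflection in the line `ℝ ∙ v` lies on
that line. -/
theorem integral_mem_span_singleton_of_reflection {E : Type*} [NormedAddCommGroup E]
    [InnerProductSpace ℝ E] [MeasurableSpace E] [BorelSpace E] [FiniteDimensional ℝ E] (v : E)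
    {F : E → E} (hF : ∀ k, F ((ℝ ∙ v).reflection k) = (ℝ ∙ v).reflection (F k)) :
    ∫ k, F k ∈ ℝ ∙ v := by
  rw [← Submodule.reflection_eq_self_iff,
    ← LinearIsometryEquiv.coe_toLinearIsometry, ← LinearIsometry.integral_comp_comm]
  simp only [LinearIsometryEquiv.coe_toLinearIsometry, ← hF]
  exact (ℝ ∙ v).reflection.measurePreserving.integral_comp
    (ℝ ∙ v).reflection.toHomeomorph.measurableEmbedding F

/-- The field part of the soliton momentum evaluates to
`m_e |v|⁻² [ (1+v²)/(2|v|) log((1+|v|)/(1-|v|)) - 1 ] v`, and hence the total soliton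
momentum is `m_b γ v` plus this field contribution. -/
theorem soliton_field_momentum_formula
    (ρhat : EuclideanSpace ℝ (Fin 3) → ℝ)
    (hrad : ∃ f : ℝ → ℝ, ∀ k, ρhat k = f ‖k‖)
    (m_b m_e : ℝ)
    (hme : m_e = (1/2) * ∫ k : EuclideanSpace ℝ (Fin 3), (ρhat k)^2 / ‖k‖^2)
    (hint2 : Integrable fun k : EuclideanSpace ℝ (Fin 3) => (ρhat k)^2 / ‖k‖^2)
    (v : EuclideanSpace ℝ (Fin 3)) (hv0 : 0 < ‖v‖) (hv1 : ‖v‖ < 1)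
    (hint : Integrable fun k : EuclideanSpace ℝ (Fin 3) =>
      (ρhat k)^2 • ((‖k‖^2 - ⟪k, v⟫^2)⁻¹ • v
        - ((1 - ‖v‖^2) * ((‖k‖^2 - ⟪k, v⟫^2)^2)⁻¹ * ⟪k, v⟫) • k)) :
    (∫ k : EuclideanSpace ℝ (Fin 3),
        (ρhat k)^2 • ((‖k‖^2 - ⟪k, v⟫^2)⁻¹ • v
          - ((1 - ‖v‖^2) * ((‖k‖^2 - ⟪k, v⟫^2)^2)⁻¹ * ⟪k, v⟫) • k))
      = (m_e * (‖v‖^2)⁻¹ *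
          ((1 + ‖v‖^2) / (2 * ‖v‖) * Real.log ((1 + ‖v‖) / (1 - ‖v‖)) - 1)) • v
    ∧ (m_b * (Real.sqrt (1 - ‖v‖^2))⁻¹) • v
        + (∫ k : EuclideanSpace ℝ (Fin 3),
            (ρhat k)^2 • ((‖k‖^2 - ⟪k, v⟫^2)⁻¹ • v
              - ((1 - ‖v‖^2) * ((‖k‖^2 - ⟪k, v⟫^2)^2)⁻¹ * ⟪k, v⟫) • k))
      = (m_b * (Real.sqrt (1 - ‖v‖^2))⁻¹
          + m_e * (‖v‖^2)⁻¹ *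
            ((1 + ‖v‖^2) / (2 * ‖v‖) * Real.log ((1 + ‖v‖) / (1 - ‖v‖)) - 1)) • v := by
  obtain ⟨f, hf⟩ := hrad
  set F : EuclideanSpace ℝ (Fin 3) → EuclideanSpace ℝ (Fin 3) := fun k ↦
    (ρhat k)^2 • ((‖k‖^2 - ⟪k, v⟫^2)⁻¹ • v
      - ((1 - ‖v‖^2) * ((‖k‖^2 - ⟪k, v⟫^2)^2)⁻¹ * ⟪k, v⟫) • k) with hF
  set s : ℝ := ‖v‖ with hs
  have hs_ne : s ≠ 0 := hv0.ne'
  set e : EuclideanSpace ℝ (Fin 3) := s⁻¹ • v with he_def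
  have he : ‖e‖ = 1 := by
    rw [he_def, norm_smul, norm_inv, Real.norm_eq_abs, abs_of_pos hv0, ← hs,
      inv_mul_cancel₀ hs_ne]
  have hve : v = s • e := by rw [he_def, smul_inv_smul₀ hs_ne]
  set h : ℝ → ℝ := fun x ↦
    (1 - s ^ 2 * x)⁻¹ - (1 - s ^ 2) * ((1 - s ^ 2 * x) ^ 2)⁻¹ * x with hh
  have hne : ∀ x ∈ Set.Icc (0 : ℝ) 1, 1 - s ^ 2 * x ≠ 0 := by
    intro x hx
    have : s ^ 2 < 1 := by nlinarith
    nlinarith [hx.1, hx.2, sq_nonneg s]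
  have hcont : ContinuousOn h (Set.Icc 0 1) := by
    have hc : ContinuousOn (fun x : ℝ ↦ 1 - s ^ 2 * x) (Set.Icc 0 1) := by fun_prop
    exact (hc.inv₀ hne).sub ((continuousOn_const.mul
      ((hc.pow 2).inv₀ fun t ht ↦ pow_ne_zero 2 (hne t ht))).mul continuousOn_id)
  have hmain : ∫ k, F k = (m_e * (s^2)⁻¹ *
      ((1 + s^2) / (2 * s) * Real.log ((1 + s) / (1 - s)) - 1)) • v := by
    obtain ⟨c, hc⟩ := Submodule.mem_span_singleton.1
      (integral_mem_span_singleton_of_reflection v (F := F) (by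
        intro k
        have hv : (ℝ ∙ v).reflection v = v :=
          Submodule.reflection_mem_subspace_eq_self (Submodule.mem_span_singleton_self v)
        have hinner : ⟪(ℝ ∙ v).reflection k, v⟫ = ⟪k, v⟫ := by
          simpa only [hv] using (ℝ ∙ v).reflection.inner_map_map k v
        simp only [hF, hf, LinearIsometryEquiv.norm_map, hinner, map_smul, map_sub, hv]))
    have hpair : ∫ k, ⟪v, F k⟫ = c * s ^ 2 := by
      rw [integral_inner hint, ← hc, real_inner_smul_right, real_inner_self_eq_norm_sq]
    have hpolar : ∀ k, ⟪v, F k⟫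
        = s ^ 2 * (h (⟪‖k‖⁻¹ • k, e⟫ ^ 2) * (f ‖k‖ ^ 2 / ‖k‖ ^ 2)) := by
      intro k
      rcases eq_or_ne k 0 with rfl | hk
      · simp [hF]
      · have hk' : ‖k‖ ≠ 0 := norm_ne_zero_iff.2 hk
        set c := ⟪‖k‖⁻¹ • k, e⟫ with hc
        have hkv : ⟪k, v⟫ = s * ‖k‖ * c := by
          rw [hc, hve, real_inner_smul_left, real_inner_smul_right]
          field_simp
        have hD : ‖k‖ ^ 2 - (s * ‖k‖ * c) ^ 2 = ‖k‖ ^ 2 * (1 - s ^ 2 * c ^ 2) := by ring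
        simp only [hF, hh, inner_smul_right, inner_sub_right, real_inner_self_eq_norm_sq,
          real_inner_comm k v, hkv, hD, hf, ← hs]
        simp only [mul_inv, mul_pow, ← inv_pow]
        generalize (1 - s ^ 2 * c ^ 2)⁻¹ = D
        field_simp
    have hnorm := integral_direction_mul_norm
      (volume : Measure (EuclideanSpace ℝ (Fin 3))) (fun _ ↦ 1) (fun r ↦ f r ^ 2 / r ^ 2)
    have hone := integral_sphere_comp_inner_sq he (h := fun _ ↦ 1) continuousOn_const
    have hval := integral_sphere_comp_inner_sq he hcont
    simp only [one_mul, hone, ← hf] at hnorm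
    simp_rw [hpolar] at hpair
    rw [integral_const_mul, integral_direction_mul_norm volume (fun ω ↦ h (⟪ω, e⟫ ^ 2))
      (fun r ↦ f r ^ 2 / r ^ 2), hval, integral_angular_momentum_density hv0 hv1] at hpair
    rw [← hc, hme, hnorm, intervalIntegral.integral_const]
    congr 1
    refine mul_right_cancel₀ (pow_ne_zero 2 hs_ne) (hpair.symm.trans ?_)
    rw [mul_inv]
    simp only [sub_zero, smul_eq_mul]
    ring
  exact ⟨hmain, by rw [hmain, ← add_smul]⟩
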